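/- Let A ∈ ℝ^{d1×d2} have nonzero rows A_1, …, A_{d1} and let à be its row-normalized version. Fix the worker/category data and the probabilities P(t, g | τ), g_0(t) as in the context, let 1 ≤ d0 ≤ d1, and define Q_min = min over size-d0 subsets τ ⊆ [d1] and t ∈ τ of Σ_{g=g_0(t)}^{n_t} P(t, g | τ). Then for all x, x* ∈ ℝ^{d2}: (1 / C(d1, d0)) · Σ_{τ ⊆ [d1], |τ| = d0} Σ_{t ∈ τ} (Σ_{g=g_0(t)}^{n_t} P(t, g | τ)) · ⟨A_t, x − x*⟩² / ‖A_t‖₂² ≥ Q_min · (d0 / d1) · σ_min(Ã)² · ‖x − x*‖₂². -/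

import Mathlib

open Finset Polynomial

/-- `∑_{j=0}^{g−1} C(mc, j) x^j`. -/
noncomputable def catPoly (mc g : ℕ) : Polynomial ℕ :=
  ∑ j ∈ Finset.range g, Polynomial.C (mc.choose j) * Polynomial.X ^ j

/-- `a^t_{g,ℓ}`: coefficient of `x^{n−g}` in `∏_{ℓ'≠ℓ} (∑_{j=0}^{g−1} C(m ℓ', j) x^j)`. -/
noncomputable def aCoeff (k : ℕ) (m : Fin (k + 1) → ℕ) (n g : ℕ) (ℓ : Fin (k + 1)) : ℕ :=
  (∏ ℓ' ∈ Finset.univ.erase ℓ, catPoly (m ℓ') g).coeff (n - g)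

/-- `b^s_g`: coefficient of `x^n` in `∏_{ℓ=0}^{k} (∑_{j=0}^{g−1} C(m ℓ, j) x^j)`. -/
noncomputable def bCoeff (k : ℕ) (m : Fin (k + 1) → ℕ) (n g : ℕ) : ℕ :=
  (∏ ℓ : Fin (k + 1), catPoly (m ℓ) g).coeff n

/-- `P(t, ℓ, g | τ) = [C(m t ℓ, g)·a^t_{g,ℓ}/C(N t, n t)]·∏_{s∈τ\{t}} b^s_g/C(N s, n s)`. -/
noncomputable def Pfun {ι : Type*} [DecidableEq ι] (k : ℕ) (N n : ι → ℕ)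
    (m : ι → Fin (k + 1) → ℕ) (t : ι) (ℓ : Fin (k + 1)) (g : ℕ) (τ : Finset ι) : ℝ :=
  (((m t ℓ).choose g * aCoeff k (m t) (n t) g ℓ : ℕ) : ℝ) / ((N t).choose (n t) : ℝ) *
    ∏ s ∈ τ.erase t, ((bCoeff k (m s) (n s) g : ℕ) : ℝ) / ((N s).choose (n s) : ℝ)

/-- `P(t, g | τ) = ∑_ℓ P(t, ℓ, g | τ)`. -/
noncomputable def Pmode {ι : Type*} [DecidableEq ι] (k : ℕ) (N n : ι → ℕ)
    (m : ι → Fin (k + 1) → ℕ) (t : ι) (g : ℕ) (τ : Finset ι) : ℝ :=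
  ∑ ℓ : Fin (k + 1), Pfun k N n m t ℓ g τ

/-- Minimal mode number `g₀(t) = max(⌈n t/(k+1)⌉, ⌈n t · m t 0 / N t⌉)`. -/
noncomputable def gZero {ι : Type*} (k : ℕ) (N n : ι → ℕ)
    (m : ι → Fin (k + 1) → ℕ) (t : ι) : ℕ :=
  max ⌈(n t : ℚ) / (k + 1)⌉₊ ⌈(n t * m t 0 : ℚ) / (N t : ℚ)⌉₊

/-- `Q_max(t, g, τ') = (max_ℓ C(m t ℓ, g)·a^t_{g,ℓ}/C(N t, n t))·∏_{s∈τ'} b^s_g/C(N s, n s)`. -/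
noncomputable def Qmax {ι : Type*} [DecidableEq ι] (k : ℕ) (N n : ι → ℕ)
    (m : ι → Fin (k + 1) → ℕ) (t : ι) (g : ℕ) (τ' : Finset ι) : ℝ :=
  (Finset.univ.sup' ⟨0, Finset.mem_univ 0⟩ fun ℓ : Fin (k + 1) =>
      (((m t ℓ).choose g * aCoeff k (m t) (n t) g ℓ : ℕ) : ℝ) / ((N t).choose (n t) : ℝ)) *
    ∏ s ∈ τ', ((bCoeff k (m s) (n s) g : ℕ) : ℝ) / ((N s).choose (n s) : ℝ)

/-- `Q_min`: the minimum over size-`d0` subsets `τ ⊆ [d1]` and `t ∈ τ` of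
`∑_{g=g₀(t)}^{n t} P(t, g | τ)`. -/
noncomputable def Qmin (d1 k d0 : ℕ) (N n : Fin d1 → ℕ) (m : Fin d1 → Fin (k + 1) → ℕ) : ℝ :=
  sInf {x : ℝ | ∃ τ ∈ Finset.powersetCard d0 (Finset.univ : Finset (Fin d1)), ∃ t ∈ τ,
    x = ∑ g ∈ Finset.Icc (gZero k N n m t) (n t), Pmode k N n m t g τ}

/-- `β_t = ∑_{τ' ⊆ [d1]\{t}, |τ'| = d0−1} ∑_{g=g₀(t)}^{n t} (1/C(d1, d0))·Q_max(t, g, τ')`. -/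
noncomputable def betaCoef (d1 k d0 : ℕ) (N n : Fin d1 → ℕ)
    (m : Fin d1 → Fin (k + 1) → ℕ) (t : Fin d1) : ℝ :=
  ∑ τ' ∈ Finset.powersetCard (d0 - 1) ((Finset.univ : Finset (Fin d1)).erase t),
    ∑ g ∈ Finset.Icc (gZero k N n m t) (n t), (1 / (d1.choose d0 : ℝ)) * Qmax k N n m t g τ'

/-- The smallest singular value of `M`: the largest `σ ≥ 0` with `‖My‖₂ ≥ σ‖y‖₂` for all `y`. -/
noncomputable def sigmaMin {d1 d2 : ℕ} (M : Matrix (Fin d1) (Fin d2) ℝ) : ℝ :=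
  sSup {σ : ℝ | 0 ≤ σ ∧ ∀ y : Fin d2 → ℝ,
    σ * Real.sqrt (∑ i, y i ^ 2) ≤ Real.sqrt (∑ i, (∑ j, M i j * y j) ^ 2)}

theorem sigmaMin_sq_mul_le {d1 d2 : ℕ} (M : Matrix (Fin d1) (Fin d2) ℝ) (y : Fin d2 → ℝ) :
    sigmaMin M ^ 2 * ∑ i, y i ^ 2 ≤ ∑ i, (∑ j, M i j * y j) ^ 2 := by
  have hR : 0 ≤ ∑ i, (∑ j, M i j * y j) ^ 2 := Finset.sum_nonneg fun _ _ => sq_nonneg _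
  have hy : 0 ≤ ∑ i, y i ^ 2 := Finset.sum_nonneg fun _ _ => sq_nonneg _
  rcases hy.eq_or_lt with h0 | hpos
  · rw [← h0, mul_zero]
    exact hR
  have hs : 0 < √(∑ i, y i ^ 2) := Real.sqrt_pos.mpr hpos
  have hle : sigmaMin M ≤ √(∑ i, (∑ j, M i j * y j) ^ 2) / √(∑ i, y i ^ 2) := by
    refine Real.sSup_le (fun σ hσ => ?_) (by positivity)
    exact (le_div_iff₀ hs).mpr (hσ.2 y)
  have hnn : 0 ≤ sigmaMin M := Real.sSup_nonneg fun σ hσ => hσ.1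
  have h := pow_le_pow_left₀ (mul_nonneg hnn hs.le) ((le_div_iff₀ hs).mp hle) 2
  rwa [mul_pow, Real.sq_sqrt hy, Real.sq_sqrt hR] at h

theorem Pmode_nonneg {ι : Type*} [DecidableEq ι] (k : ℕ) (N n : ι → ℕ)
    (m : ι → Fin (k + 1) → ℕ) (t : ι) (g : ℕ) (τ : Finset ι) : 0 ≤ Pmode k N n m t g τ :=
  Finset.sum_nonneg fun _ _ => mul_nonneg (by positivity)
    (Finset.prod_nonneg fun _ _ => by positivity)

theorem Qmin_nonneg (d1 k d0 : ℕ) (N n : Fin d1 → ℕ) (m : Fin d1 → Fin (k + 1) → ℕ) :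
    0 ≤ Qmin d1 k d0 N n m := by
  refine Real.sInf_nonneg ?_
  rintro x ⟨τ, -, t, -, rfl⟩
  exact Finset.sum_nonneg fun _ _ => Pmode_nonneg ..

theorem Qmin_le {d1 k d0 : ℕ} {N n : Fin d1 → ℕ} {m : Fin d1 → Fin (k + 1) → ℕ}
    {τ : Finset (Fin d1)} (hτ : τ ∈ Finset.powersetCard d0 (Finset.univ : Finset (Fin d1)))
    {t : Fin d1} (ht : t ∈ τ) :
    Qmin d1 k d0 N n m ≤ ∑ g ∈ Finset.Icc (gZero k N n m t) (n t), Pmode k N n m t g τ := by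
  refine csInf_le ⟨0, ?_⟩ ⟨τ, hτ, t, ht, rfl⟩
  rintro x ⟨τ, -, t, -, rfl⟩
  exact Finset.sum_nonneg fun _ _ => Pmode_nonneg ..

theorem card_filter_mem_powersetCard {ι : Type*} [DecidableEq ι] {s : Finset ι} {t : ι}
    (ht : t ∈ s) (d : ℕ) :
    #{τ ∈ Finset.powersetCard (d + 1) s | t ∈ τ} = (#s - 1).choose d := by
  simpa using Finset.card_filter_powersetCard_subset {t} s (d + 1) (by simpa using ht) (by simp)

theorem sum_powersetCard_sum {ι : Type*} [DecidableEq ι] (s : Finset ι) (d : ℕ) (f : ι → ℝ) :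
    ∑ τ ∈ Finset.powersetCard (d + 1) s, ∑ t ∈ τ, f t =
      ((#s - 1).choose d : ℝ) * ∑ t ∈ s, f t := by
  rw [Finset.sum_comm' (t' := s) (s' := fun t => {τ ∈ Finset.powersetCard (d + 1) s | t ∈ τ}),
    Finset.mul_sum]
  · refine Finset.sum_congr rfl fun t ht => ?_
    rw [Finset.sum_const, card_filter_mem_powersetCard ht, nsmul_eq_mul]
  · intro τ t
    simp only [Finset.mem_filter]
    exact ⟨fun h => ⟨h, (Finset.mem_powersetCard.mp h.1).1 h.2⟩, fun h => h.1⟩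

/-- Lower bound for the expected sampled squared residual: with
rows sampled as size-`d0` subsets `τ` uniformly at random and mode probabilities
`P(t, g | τ)`, for all `x, x*`,
`(1/C(d1,d0))·∑_τ ∑_{t∈τ} (∑_{g=g₀(t)}^{n t} P(t,g|τ))·⟨A_t, x−x*⟩²/‖A_t‖₂²
  ≥ Q_min·(d0/d1)·σ_min(Ã)²·‖x−x*‖₂²`. -/
theorem stmt_7 (d1 d2 k d0 : ℕ) (hd0 : 1 ≤ d0) (hd0' : d0 ≤ d1)
    (A : Matrix (Fin d1) (Fin d2) ℝ) (hA : ∀ t, ∑ j, A t j ^ 2 ≠ 0)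
    (Atil : Matrix (Fin d1) (Fin d2) ℝ)
    (hAtil : ∀ t j, Atil t j = A t j / Real.sqrt (∑ j', A t j' ^ 2))
    (N n : Fin d1 → ℕ) (m : Fin d1 → Fin (k + 1) → ℕ)
    (hnN : ∀ r, n r ≤ N r) (hmN : ∀ r, ∑ ℓ, m r ℓ = N r)
    (x xstar : Fin d2 → ℝ) :
    Qmin d1 k d0 N n m * ((d0 : ℝ) / (d1 : ℝ)) * sigmaMin Atil ^ 2 *
        ∑ j, (x j - xstar j) ^ 2
      ≤ (1 / (d1.choose d0 : ℝ)) *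
          ∑ τ ∈ Finset.powersetCard d0 (Finset.univ : Finset (Fin d1)),
            ∑ t ∈ τ,
              (∑ g ∈ Finset.Icc (gZero k N n m t) (n t), Pmode k N n m t g τ) *
                (∑ j, A t j * (x j - xstar j)) ^ 2 / (∑ j, A t j ^ 2) := by
  have hrow : ∀ t, (∑ j, Atil t j * (x j - xstar j)) ^ 2 =
      (∑ j, A t j * (x j - xstar j)) ^ 2 / ∑ j, A t j ^ 2 := by
    intro t
    have h : ∑ j, Atil t j * (x j - xstar j) =
        (∑ j, A t j * (x j - xstar j)) / √(∑ j, A t j ^ 2) := by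
      rw [Finset.sum_div]
      exact Finset.sum_congr rfl fun j _ => by rw [hAtil, div_mul_eq_mul_div]
    rw [h, div_pow, Real.sq_sqrt (Finset.sum_nonneg fun _ _ => sq_nonneg _)]
  have hσ := sigmaMin_sq_mul_le Atil fun j => x j - xstar j
  have hQ := Qmin_nonneg d1 k d0 N n m
  set c : Fin d1 → ℝ := fun t => (∑ j, Atil t j * (x j - xstar j)) ^ 2
  have hbound : Qmin d1 k d0 N n m *
        ∑ τ ∈ Finset.powersetCard d0 (Finset.univ : Finset (Fin d1)), ∑ t ∈ τ, c t ≤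
      ∑ τ ∈ Finset.powersetCard d0 (Finset.univ : Finset (Fin d1)), ∑ t ∈ τ,
        (∑ g ∈ Finset.Icc (gZero k N n m t) (n t), Pmode k N n m t g τ) *
          (∑ j, A t j * (x j - xstar j)) ^ 2 / (∑ j, A t j ^ 2) := by
    rw [Finset.mul_sum]
    refine Finset.sum_le_sum fun τ hτ => ?_
    rw [Finset.mul_sum]
    refine Finset.sum_le_sum fun t ht => ?_
    rw [mul_div_assoc, ← hrow]
    exact mul_le_mul_of_nonneg_right (Qmin_le hτ ht) (sq_nonneg _)
  obtain ⟨d, rfl⟩ : ∃ d, d0 = d + 1 := ⟨d0 - 1, by omega⟩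
  obtain ⟨e, rfl⟩ : ∃ e, d1 = e + 1 := ⟨d1 - 1, by omega⟩
  rw [sum_powersetCard_sum, Finset.card_univ, Fintype.card_fin, Nat.add_sub_cancel] at hbound
  have hch : (0 : ℝ) < ((e + 1).choose (d + 1) : ℕ) := by
    exact_mod_cast Nat.choose_pos hd0'
  have hratio : (((d + 1 : ℕ) : ℝ) / ((e + 1 : ℕ) : ℝ)) =
      1 / ((e + 1).choose (d + 1) : ℝ) * (e.choose d : ℝ) := by
    have h : ((e + 1 : ℕ) : ℝ) * (e.choose d : ℝ) =
        ((e + 1).choose (d + 1) : ℝ) * ((d + 1 : ℕ) : ℝ) := by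
      exact_mod_cast Nat.add_one_mul_choose_eq e d
    have he : ((e + 1 : ℕ) : ℝ) ≠ 0 := by positivity
    rw [one_div_mul_eq_div, div_eq_div_iff he hch.ne']
    linarith
  calc _ ≤ Qmin (e + 1) k (d + 1) N n m * (((d + 1 : ℕ) : ℝ) / ((e + 1 : ℕ) : ℝ)) * ∑ t, c t := by
        rw [mul_assoc _ (sigmaMin Atil ^ 2)]
        exact mul_le_mul_of_nonneg_left hσ (by positivity)
    _ = 1 / ((e + 1).choose (d + 1) : ℝ) *
          (Qmin (e + 1) k (d + 1) N n m * ((e.choose d : ℝ) * ∑ t, c t)) := by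
        rw [hratio]
        ring
    _ ≤ _ := mul_le_mul_of_nonneg_left hbound (by positivity)
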